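/- Let h₁ and h₂ define distinct parabolic bisectors with common focus: h₁, h₂ are self-adjoint of rank 2 with trace 0, B_{h₁} ≠ B_{h₂}, and there is a nonzero isotropic f ∈ V (⟨f,f⟩ = 0) with h₁ f = 0 and h₂ f = 0. Let R₁, R₂ be the real spines of B_{h₁}, B_{h₂}. Then the following are equivalent: (i) B_{h₁} ∩ B_{h₂} contains no negative point; (ii) R₁ ∩ R₂ = {[f]}; (iii) the ℝ-linear span of h₁ and h₂ contains the map x ↦ ⟨x,f⟩·f. -/

import Mathlib

open scoped ComplexConjugate

noncomputable section

/-- `V` is `ℂ³`. -/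
abbrev V3 : Type := Fin 3 → ℂ

/-- The hermitian form of signature `(2,1)`:
`⟨x,y⟩ = x₀·conj y₀ + x₁·conj y₁ − x₂·conj y₂`. -/
def herm (x y : V3) : ℂ := x 0 * conj (y 0) + x 1 * conj (y 1) - x 2 * conj (y 2)

/-- The complex projective plane `ℙ(V)`. -/
abbrev PV : Type := Projectivization ℂ V3

/-- The class `[v]` of a nonzero vector `v` in `ℙ(V)`. -/
def projMk (v : V3) (hv : v ≠ 0) : PV := Projectivization.mk ℂ v hv

/-- A map `h` is self-adjoint (`h* = h`) w.r.t. the hermitian form. -/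
def SelfAdj (h : Module.End ℂ V3) : Prop := ∀ x y : V3, herm (h x) y = herm x (h y)

/-- The set `B_h = {[v] ∈ ℙ(V) | ⟨h v, v⟩ = 0}`. -/
def Bset (h : Module.End ℂ V3) : Set PV :=
  {q | ∃ v : V3, ∃ hv : v ≠ 0, q = projMk v hv ∧ herm (h v) v = 0}

/-- `h` defines a bisector: self-adjoint, trace `0`, rank `2`, and `B_h` contains
a point other than the focus (i.e. a point `[v]` with `h v ≠ 0`). -/
def IsBisector (h : Module.End ℂ V3) : Prop :=
  SelfAdj h ∧ LinearMap.trace ℂ V3 h = 0 ∧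
    Module.finrank ℂ (LinearMap.range h) = 2 ∧ ∃ v : V3, herm (h v) v = 0 ∧ h v ≠ 0

/-- A linear family of bisectors: an `ℝ`-subspace of self-adjoint traceless
degenerate maps whose base contains a negative point. -/
def IsLinearFamily (W : Submodule ℝ (Module.End ℂ V3)) : Prop :=
  (∀ h ∈ W, SelfAdj h ∧ LinearMap.trace ℂ V3 h = 0 ∧ LinearMap.det h = 0) ∧
    ∃ v : V3, ∃ hv : v ≠ 0, (herm v v).re < 0 ∧ ∀ h ∈ W, herm (h v) v = 0

/-- The map `x ↦ ⟨x,p⟩·p`. -/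
def wmap (p : V3) : Module.End ℂ V3 where
  toFun x := herm x p • p
  map_add' x y := by
    show herm (x + y) p • p = herm x p • p + herm y p • p
    have : herm (x + y) p = herm x p + herm y p := by
      simp only [herm, Pi.add_apply]; ring
    rw [this, add_smul]
  map_smul' c x := by
    show herm (c • x) p • p = c • (herm x p • p)
    have : herm (c • x) p = c * herm x p := by
      simp only [herm, Pi.smul_apply, smul_eq_mul]; ring
    rw [this, mul_smul]

/-- `ℙ(U)` for a complex subspace `U`. -/
def projC (U : Submodule ℂ V3) : Set PV :=
  {q | ∃ v : V3, ∃ hv : v ≠ 0, v ∈ U ∧ q = projMk v hv}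

/-- `ℙ(T)` for a real subspace `T`. -/
def projR (T : Submodule ℝ V3) : Set PV :=
  {q | ∃ v : V3, ∃ hv : v ≠ 0, v ∈ T ∧ q = projMk v hv}

/-- An `ℝ`-plane: `ℙ(T)` for a totally real `3`-dimensional real subspace `T`
with `ℂ·T = V`. -/
def IsRealPlane (T : Submodule ℝ V3) : Prop :=
  Module.finrank ℝ T = 3 ∧ Submodule.span ℂ (T : Set V3) = ⊤ ∧
    ∀ t ∈ T, ∀ t' ∈ T, (herm t t').im = 0

/-- A geodesic: `ℙ(W₀)` for a `2`-dimensional real subspace `W₀` on which the form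
is real-valued and not identically zero. -/
def IsGeodesic (W₀ : Submodule ℝ V3) : Prop :=
  Module.finrank ℝ W₀ = 2 ∧ (∀ w ∈ W₀, ∀ w' ∈ W₀, (herm w w').im = 0) ∧
    ∃ w ∈ W₀, ∃ w' ∈ W₀, herm w w' ≠ 0

/-- The real spine `R = {[h v] | [v] ∈ B_h, h v ≠ 0}` of `B_h`. -/
def RealSpine (h : Module.End ℂ V3) : Set PV :=
  {q | ∃ v : V3, ∃ hnz : h v ≠ 0, herm (h v) v = 0 ∧ q = projMk (h v) hnz}

/-- The orthogonal complement w.r.t. the hermitian form. -/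
def hermOrth (U : Submodule ℂ V3) : Submodule ℂ V3 where
  carrier := {x | ∀ u ∈ U, herm x u = 0}
  add_mem' := by
    intro a b ha hb u hu
    have h1 : herm (a + b) u = herm a u + herm b u := by
      simp only [herm, Pi.add_apply]; ring
    rw [h1, ha u hu, hb u hu, add_zero]
  zero_mem' := by
    intro u hu
    simp [herm]
  smul_mem' := by
    intro c x hx u hu
    have h1 : herm (c • x) u = c * herm x u := by
      simp only [herm, Pi.smul_apply, smul_eq_mul]; ring
    rw [h1, hx u hu, mul_zero]


theorem herm_add_left (x y z : V3) : herm (x + y) z = herm x z + herm y z := by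
  simp only [herm, Pi.add_apply]; ring

theorem herm_smul_left (a : ℂ) (x z : V3) : herm (a • x) z = a * herm x z := by
  simp only [herm, Pi.smul_apply, smul_eq_mul]; ring

theorem herm_conj (x y : V3) : conj (herm x y) = herm y x := by
  simp only [herm, map_add, map_sub, map_mul, Complex.conj_conj]; ring

theorem herm_add_right (x y z : V3) : herm z (x + y) = herm z x + herm z y := by
  simp only [herm, Pi.add_apply, map_add]; ring

theorem herm_smul_right (a : ℂ) (x z : V3) : herm z (a • x) = conj a * herm z x := by
  simp only [herm, Pi.smul_apply, smul_eq_mul, map_mul]; ring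

theorem herm_zero_left (x : V3) : herm 0 x = 0 := by simp [herm]

/-- The linear functional `⟨-, p⟩`. -/
def hermDual (p : V3) : V3 →ₗ[ℂ] ℂ where
  toFun x := herm x p
  map_add' x y := herm_add_left x y p
  map_smul' a x := herm_smul_left a x p

/-- `f`, `c`, `g` is a Witt frame: `f`, `g` is a hyperbolic pair and `c` a unit vector
orthogonal to both. -/
structure WittFrame (f c g : V3) : Prop where
  ff : herm f f = 0
  fg : herm f g = 1
  gg : herm g g = 0
  cc : herm c c = 1
  cf : herm c f = 0
  cg : herm c g = 0
  expand : ∀ v, v = herm v g • f + herm v c • c + herm v f • g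

namespace WittFrame

variable {f c g : V3}

theorem gf (F : WittFrame f c g) : herm g f = 1 := by rw [← herm_conj, F.fg, map_one]

theorem fc (F : WittFrame f c g) : herm f c = 0 := by rw [← herm_conj, F.cf, map_zero]

theorem gc (F : WittFrame f c g) : herm g c = 0 := by rw [← herm_conj, F.cg, map_zero]

end WittFrame

theorem exists_wittFrame (f : V3) (hf0 : f ≠ 0) (hiso : herm f f = 0) :
    ∃ c g : V3, WittFrame f c g := by
  have h2 : f 2 ≠ 0 := by
    intro h
    apply hf0
    have h' := congrArg Complex.re hiso
    simp only [herm, h, Complex.mul_conj, zero_mul, sub_zero] at h'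
    norm_cast at h'
    have h0 := Complex.normSq_nonneg (f 0)
    have h1 := Complex.normSq_nonneg (f 1)
    have e0 : f 0 = 0 := Complex.normSq_eq_zero.1 (by linarith)
    have e1 : f 1 = 0 := Complex.normSq_eq_zero.1 (by linarith)
    ext i
    fin_cases i <;> simp [h, e0, e1]
  obtain ⟨n, hn0, hcn, hn⟩ : ∃ n : ℂ, n ≠ 0 ∧ conj n = n ∧ f 2 * conj (f 2) = n ^ 2 :=
    ⟨(‖f 2‖ : ℂ), by simpa using h2, Complex.conj_ofReal _, Complex.mul_conj' _⟩
  have hm : f 0 * conj (f 0) + f 1 * conj (f 1) = n ^ 2 := by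
    rw [← hn, ← sub_eq_zero]; exact hiso
  have hc2 : conj (2 : ℂ) = 2 := map_ofNat _ 2
  refine ⟨![conj (f 1) / n, -conj (f 0) / n, 0],
    ![f 0 / (2 * n ^ 2), f 1 / (2 * n ^ 2), - f 2 / (2 * n ^ 2)], hiso, ?_, ?_, ?_, ?_, ?_, ?_⟩
  · simp [herm, hcn, hc2]
    field_simp
    linear_combination hm + hn
  · simp [herm, hcn, hc2]
    field_simp
    linear_combination hm - hn
  · simp [herm, hcn]
    field_simp
    linear_combination hm
  · simp [herm]
    field_simp
    ring
  · simp [herm, hcn, hc2]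
    field_simp
    ring
  · intro v
    ext i
    fin_cases i
    · simp [herm, hcn, hc2, Matrix.vecHead, Matrix.vecTail]
      field_simp
      linear_combination (-2 * v 0) * hm
    · simp [herm, hcn, hc2, Matrix.vecHead, Matrix.vecTail]
      field_simp
      linear_combination (-2 * v 1) * hm
    · simp [herm, hcn, hc2, Matrix.vecHead, Matrix.vecTail]
      field_simp
      linear_combination (-2 * v 2) * hn

/-- `h` has the normal form of a parabolic bisector with parameters `α`, `γ`
in the frame `f`, `c`. -/
def HasForm (f c : V3) (h : Module.End ℂ V3) (α : ℂ) (γ : ℝ) : Prop :=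
  ∀ x, h x = (herm x c * α + herm x f * γ) • f + (herm x f * conj α) • c

theorem IsBisector.exists_hasForm {f c g : V3} (F : WittFrame f c g) {h : Module.End ℂ V3}
    (hb : IsBisector h) (hf : h f = 0) : ∃ (α : ℂ) (γ : ℝ), α ≠ 0 ∧ HasForm f c h α γ := by
  obtain ⟨hs, htr, hrk, -⟩ := hb
  have horth : ∀ x, herm (h x) f = 0 := fun x => by
    rw [hs, hf, ← herm_conj, herm_zero_left, map_zero]
  have hexp : ∀ x, h x = herm x c • h c + herm x f • h g := fun x => by
    conv_lhs => rw [F.expand x]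
    rw [map_add, map_add, map_smul, map_smul, map_smul, hf, smul_zero, zero_add]
  have hdec : h = (hermDual c).smulRight (h c) + (hermDual f).smulRight (h g) :=
    LinearMap.ext hexp
  have hβ : herm (h c) c = 0 := by
    have h1 := htr
    rw [hdec, map_add, LinearMap.trace_smulRight, LinearMap.trace_smulRight] at h1
    change herm (h c) c + herm (h g) f = 0 at h1
    rwa [horth, add_zero] at h1
  have hγ : ((herm (h g) g).re : ℂ) = herm (h g) g := by
    rw [← Complex.conj_eq_iff_re, herm_conj, hs]
  have hδ : herm (h g) c = conj (herm (h c) g) := by rw [herm_conj, hs]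
  have hform : HasForm f c h (herm (h c) g) (herm (h g) g).re := by
    intro x
    rw [hexp x, hγ]
    conv_lhs => rw [F.expand (h c), F.expand (h g), horth, horth, hβ, hδ]
    module
  refine ⟨_, _, ?_, hform⟩
  intro hα
  have hle : LinearMap.range h ≤ Submodule.span ℂ {f} := by
    rintro _ ⟨x, rfl⟩
    rw [hform x, hα, map_zero, mul_zero, mul_zero, zero_smul, add_zero]
    exact Submodule.smul_mem _ _ (Submodule.mem_span_singleton_self f)
  have h1 := Submodule.finrank_mono hle
  have h2 := finrank_span_le_card (R := ℂ) ({f} : Set V3)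
  rw [Set.toFinset_singleton, Finset.card_singleton] at h2
  omega

/-- The real line in `ℂ` that parametrizes the points of the bisector outside the polar line
of its focus. -/
def OnLine (α : ℂ) (γ : ℝ) (u : ℂ) : Prop := α * u + conj α * conj u + γ = 0

theorem HasForm.herm_eq_zero_iff {f c : V3} {h : Module.End ℂ V3} {α : ℂ} {γ : ℝ}
    (H : HasForm f c h α γ) {v : V3} (hz : herm v f ≠ 0) :
    herm (h v) v = 0 ↔ OnLine α γ (herm v c / herm v f) := by
  rw [H v, herm_add_left, herm_smul_left, herm_smul_left, ← herm_conj v f, ← herm_conj v c,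
    OnLine]
  have hz' : conj (herm v f) ≠ 0 := by simpa using hz
  rw [map_div₀]
  generalize herm v f = z at *
  generalize herm v c = y at *
  field_simp
  constructor <;> intro e <;> linear_combination e

theorem exists_onLine_of_ne_zero {α : ℂ} (γ : ℝ) (hα : α ≠ 0) : ∃ u, OnLine α γ u := by
  refine ⟨-γ / 2 / α, ?_⟩
  have hα' : conj α ≠ 0 := by simpa using hα
  simp only [OnLine, map_div₀, map_neg, Complex.conj_ofReal, map_ofNat]
  field_simp
  ring

theorem exists_neg_iff {f c g : V3} (F : WittFrame f c g) {h₁ h₂ : Module.End ℂ V3}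
    {α₁ α₂ : ℂ} {γ₁ γ₂ : ℝ} (H₁ : HasForm f c h₁ α₁ γ₁) (H₂ : HasForm f c h₂ α₂ γ₂) :
    (∃ v : V3, (herm v v).re < 0 ∧ herm (h₁ v) v = 0 ∧ herm (h₂ v) v = 0) ↔
      ∃ u, OnLine α₁ γ₁ u ∧ OnLine α₂ γ₂ u := by
  constructor
  · rintro ⟨v, hneg, e₁, e₂⟩
    have hz : herm v f ≠ 0 := by
      intro hz
      have : herm v v = herm v c * conj (herm v c) := by
        conv_lhs => rw [F.expand v]
        simp only [herm_add_left, herm_smul_left, herm_add_right, herm_smul_right, hz,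
          F.ff, F.fg, F.fc, F.cf, F.cc, map_zero]
        ring
      rw [this, Complex.mul_conj, Complex.ofReal_re] at hneg
      exact absurd (Complex.normSq_nonneg (herm v c)) (not_le.2 hneg)
    exact ⟨_, (H₁.herm_eq_zero_iff hz).1 e₁, (H₂.herm_eq_zero_iff hz).1 e₂⟩
  · rintro ⟨u, e₁, e₂⟩
    let v : V3 := ((-(1 + Complex.normSq u) : ℝ) : ℂ) • f + u • c + g
    have hzf : herm v f = 1 := by
      simp only [v, herm_add_left, herm_smul_left, F.ff, F.cf, F.gf]; ring
    have hyc : herm v c = u := by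
      simp only [v, herm_add_left, herm_smul_left, F.fc, F.cc, F.gc]; ring
    have hvv : herm v v = ((-2 - Complex.normSq u : ℝ) : ℂ) := by
      simp only [v, herm_add_left, herm_smul_left, herm_add_right, herm_smul_right,
        F.ff, F.fg, F.gf, F.fc, F.cf, F.cc, F.gc, F.cg, F.gg, Complex.conj_ofReal]
      push_cast
      linear_combination Complex.mul_conj u
    have hz : herm v f ≠ 0 := by rw [hzf]; exact one_ne_zero
    refine ⟨v, ?_, ?_, ?_⟩
    · rw [hvv, Complex.ofReal_re]
      linarith [Complex.normSq_nonneg u]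
    · rw [H₁.herm_eq_zero_iff hz, hzf, hyc, div_one]; exact e₁
    · rw [H₂.herm_eq_zero_iff hz, hzf, hyc, div_one]; exact e₂

theorem WittFrame.smul_add_ne_zero {f c g : V3} (F : WittFrame f c g) (w : ℂ) :
    w • f + c ≠ 0 := by
  intro e
  have h1 : herm (w • f + c) c = 0 := by rw [e, herm_zero_left]
  rw [herm_add_left, herm_smul_left, F.fc, F.cc] at h1
  norm_num at h1

theorem mem_realSpine_iff {f c g : V3} (F : WittFrame f c g) (hf0 : f ≠ 0)
    {h : Module.End ℂ V3} {α : ℂ} {γ : ℝ} (hα : α ≠ 0) (H : HasForm f c h α γ) (q : PV) :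
    q ∈ RealSpine h ↔ q = projMk f hf0 ∨
      ∃ u, OnLine α γ u ∧ q = projMk ((-conj u) • f + c) (F.smul_add_ne_zero _) := by
  constructor
  · rintro ⟨v, hnz, e, rfl⟩
    by_cases hz : herm v f = 0
    · left
      refine (Projectivization.mk_eq_mk_iff' ℂ _ _ _ _).2 ⟨herm v c * α, ?_⟩
      rw [H v, hz]
      module
    · right
      refine ⟨_, (H.herm_eq_zero_iff hz).1 e, ?_⟩
      refine (Projectivization.mk_eq_mk_iff' ℂ _ _ _ _).2 ⟨herm v f * conj α, ?_⟩
      have hl := (H.herm_eq_zero_iff hz).1 e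
      have hy : herm v c = herm v f * (herm v c / herm v f) := by field_simp
      rw [H v]
      generalize herm v c / herm v f = u at *
      rw [hy, smul_add, smul_smul]
      congr 2
      unfold OnLine at hl
      linear_combination (-herm v f) * hl
  · rintro (rfl | ⟨u, hu, rfl⟩)
    · have hc : h c = α • f := by rw [H c, F.cc, F.cf]; module
      refine ⟨c, ?_, ?_, ?_⟩
      · rw [hc]; exact smul_ne_zero hα hf0
      · rw [hc, herm_smul_left, F.fc, mul_zero]
      · refine (Projectivization.mk_eq_mk_iff' ℂ _ _ _ _).2 ⟨α⁻¹, ?_⟩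
        rw [hc, smul_smul, inv_mul_cancel₀ hα, one_smul]
    · have hα' : conj α ≠ 0 := by simpa using hα
      let v : V3 := u • c + g
      have hzf : herm v f = 1 := by
        simp only [v, herm_add_left, herm_smul_left, F.cf, F.gf]; ring
      have hyc : herm v c = u := by
        simp only [v, herm_add_left, herm_smul_left, F.cc, F.gc]; ring
      have hv : h v = conj α • ((-conj u) • f + c) := by
        rw [H v, hzf, hyc, smul_add, smul_smul, one_mul, one_mul]
        congr 2
        unfold OnLine at hu
        linear_combination hu
      refine ⟨v, ?_, ?_, ?_⟩
      · rw [hv]; exact smul_ne_zero hα' (F.smul_add_ne_zero _)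
      · rw [H.herm_eq_zero_iff (by rw [hzf]; exact one_ne_zero), hzf, hyc, div_one]; exact hu
      · refine (Projectivization.mk_eq_mk_iff' ℂ _ _ _ _).2 ⟨(conj α)⁻¹, ?_⟩
        rw [hv, smul_smul, inv_mul_cancel₀ hα', one_smul]

theorem realSpine_inter_eq_iff {f c g : V3} (F : WittFrame f c g) (hf0 : f ≠ 0)
    {h₁ h₂ : Module.End ℂ V3} {α₁ α₂ : ℂ} {γ₁ γ₂ : ℝ} (hα₁ : α₁ ≠ 0) (hα₂ : α₂ ≠ 0)
    (H₁ : HasForm f c h₁ α₁ γ₁) (H₂ : HasForm f c h₂ α₂ γ₂) :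
    RealSpine h₁ ∩ RealSpine h₂ = {projMk f hf0} ↔
      ¬ ∃ u, OnLine α₁ γ₁ u ∧ OnLine α₂ γ₂ u := by
  constructor
  · rintro e ⟨u, hu₁, hu₂⟩
    have hm : projMk ((-conj u) • f + c) (F.smul_add_ne_zero _) ∈
        RealSpine h₁ ∩ RealSpine h₂ :=
      ⟨(mem_realSpine_iff F hf0 hα₁ H₁ _).2 (.inr ⟨u, hu₁, rfl⟩),
        (mem_realSpine_iff F hf0 hα₂ H₂ _).2 (.inr ⟨u, hu₂, rfl⟩)⟩
    rw [e, Set.mem_singleton_iff] at hm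
    obtain ⟨a, ha⟩ := (Projectivization.mk_eq_mk_iff' ℂ _ _ _ _).1 hm
    have h1 := congrArg (fun x => herm x c) ha
    simp only [herm_add_left, herm_smul_left, F.fc, F.cc, mul_zero, zero_add] at h1
    exact zero_ne_one h1
  · intro hD
    ext q
    rw [Set.mem_inter_iff, mem_realSpine_iff F hf0 hα₁ H₁, mem_realSpine_iff F hf0 hα₂ H₂,
      Set.mem_singleton_iff]
    constructor
    · rintro ⟨rfl | ⟨u, hu, rfl⟩, hq | ⟨u', hu', hq⟩⟩
      · rfl
      · rfl
      · exact hq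
      · exfalso
        obtain ⟨a, ha⟩ := (Projectivization.mk_eq_mk_iff' ℂ _ _ _ _).1 hq
        have h1 := congrArg (fun x => herm x c) ha
        have h2 := congrArg (fun x => herm x g) ha
        simp only [herm_add_left, herm_smul_left, F.fc, F.cc, F.fg, F.cg, mul_zero, zero_add,
          mul_one, add_zero] at h1 h2
        rw [h1, one_mul, neg_inj] at h2
        have h3 : u' = u := (starRingEnd ℂ).injective h2
        exact hD ⟨u, hu, h3 ▸ hu'⟩
    · rintro rfl
      exact ⟨.inl rfl, .inl rfl⟩

theorem smul_add_smul_eq_wmap_iff {f c g : V3} (F : WittFrame f c g)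
    {h₁ h₂ : Module.End ℂ V3} {α₁ α₂ : ℂ} {γ₁ γ₂ : ℝ}
    (H₁ : HasForm f c h₁ α₁ γ₁) (H₂ : HasForm f c h₂ α₂ γ₂) (a b : ℝ) :
    a • h₁ + b • h₂ = wmap f ↔ a * α₁ + b * α₂ = 0 ∧ a * γ₁ + b * γ₂ = 1 := by
  have key : ∀ x, (a • h₁ + b • h₂) x = (herm x c * (a * α₁ + b * α₂) +
      herm x f * ((a * γ₁ + b * γ₂ : ℝ) : ℂ)) • f +
      (herm x f * conj (a * α₁ + b * α₂)) • c := by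
    intro x
    change (a : ℂ) • h₁ x + (b : ℂ) • h₂ x = _
    rw [H₁ x, H₂ x]
    simp only [map_add, map_mul, Complex.conj_ofReal]
    push_cast
    module
  constructor
  · intro e
    have h1 := congrArg (fun x => herm x g) (LinearMap.congr_fun e c)
    have h2 := congrArg (fun x => herm x g) (LinearMap.congr_fun e g)
    have hw : ∀ x, wmap f x = herm x f • f := fun _ => rfl
    simp only [key, hw, herm_add_left, herm_smul_left, F.cc, F.cf, F.gc, F.gf, F.fg,
      F.cg] at h1 h2
    refine ⟨by linear_combination h1, ?_⟩
    have h3 : ((a * γ₁ + b * γ₂ : ℝ) : ℂ) = 1 := by linear_combination h2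
    exact_mod_cast h3
  · rintro ⟨e, e'⟩
    refine LinearMap.ext fun x => ?_
    rw [key, e, e']
    change _ = herm x f • f
    simp

theorem not_exists_onLine_iff {α₁ α₂ : ℂ} {γ₁ γ₂ : ℝ} (hα₁ : α₁ ≠ 0) :
    (¬ ∃ u, OnLine α₁ γ₁ u ∧ OnLine α₂ γ₂ u) ↔
      ∃ a b : ℝ, a * α₁ + b * α₂ = 0 ∧ a * γ₁ + b * γ₂ = 1 := by
  constructor
  · intro hD
    have hα₁' : conj α₁ ≠ 0 := by simpa using hα₁
    have hd : conj α₁ * α₂ - α₁ * conj α₂ = 0 := by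
      by_contra hd
      generalize hδ : conj α₁ * α₂ - α₁ * conj α₂ = δ at hd
      have hδ' : conj δ = -δ := by
        rw [← hδ]
        simp only [map_sub, map_mul, Complex.conj_conj]
        ring
      refine hD ⟨(conj α₂ * γ₁ - conj α₁ * γ₂) / δ, ?_, ?_⟩ <;>
      · simp only [OnLine, map_div₀, map_sub, map_mul, Complex.conj_conj, Complex.conj_ofReal,
          hδ']
        field_simp
        rw [← hδ]
        ring
    obtain ⟨r, hr⟩ : ∃ r : ℝ, α₂ = r * α₁ := by
      refine ⟨(α₂ / α₁).re, ?_⟩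
      rw [(Complex.conj_eq_iff_re (z := α₂ / α₁)).1, div_mul_cancel₀ _ hα₁]
      rw [map_div₀, div_eq_div_iff hα₁' hα₁]
      linear_combination -hd
    have hne : γ₂ - r * γ₁ ≠ 0 := by
      intro e
      obtain ⟨u, hu⟩ := exists_onLine_of_ne_zero γ₁ hα₁
      refine hD ⟨u, hu, ?_⟩
      have e' : γ₂ = r * γ₁ := by linarith
      unfold OnLine at hu ⊢
      rw [hr, e', map_mul, Complex.conj_ofReal]
      push_cast
      linear_combination r * hu
    refine ⟨-r / (γ₂ - r * γ₁), 1 / (γ₂ - r * γ₁), ?_, ?_⟩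
    · rw [hr]; push_cast; ring
    · field_simp
      ring
  · rintro ⟨a, b, e, e'⟩ ⟨u, hu₁, hu₂⟩
    have ec : a * conj α₁ + b * conj α₂ = 0 := by
      simpa using congrArg (starRingEnd ℂ) e
    have e'' : (a : ℂ) * γ₁ + b * γ₂ = 1 := by exact_mod_cast e'
    unfold OnLine at hu₁ hu₂
    exact one_ne_zero (α := ℂ)
      (by linear_combination a * hu₁ + b * hu₂ - u * e - conj u * ec - e'')

/-- Corollary 2.7: for distinct parabolic bisectors with common focus
`[f]`, the three conditions (empty negative intersection, parallel real spines,
`⟨-,f⟩f` in the real span) are equivalent. -/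
theorem stmt_15 (h₁ h₂ : Module.End ℂ V3)
    (hb₁ : IsBisector h₁) (hb₂ : IsBisector h₂) (hne : Bset h₁ ≠ Bset h₂)
    (f : V3) (hf0 : f ≠ 0) (hiso : herm f f = 0) (hf1 : h₁ f = 0) (hf2 : h₂ f = 0) :
    ((¬ ∃ v : V3, (herm v v).re < 0 ∧ herm (h₁ v) v = 0 ∧ herm (h₂ v) v = 0) ↔
        RealSpine h₁ ∩ RealSpine h₂ = {projMk f hf0}) ∧
      ((RealSpine h₁ ∩ RealSpine h₂ = {projMk f hf0}) ↔
        ∃ a b : ℝ, a • h₁ + b • h₂ = wmap f) := by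
  obtain ⟨c, g, F⟩ := exists_wittFrame f hf0 hiso
  obtain ⟨α₁, γ₁, hα₁, H₁⟩ := hb₁.exists_hasForm F hf1
  obtain ⟨α₂, γ₂, hα₂, H₂⟩ := hb₂.exists_hasForm F hf2
  rw [exists_neg_iff F H₁ H₂, realSpine_inter_eq_iff F hf0 hα₁ hα₂ H₁ H₂]
  refine ⟨Iff.rfl, ?_⟩
  simp only [smul_add_smul_eq_wmap_iff F H₁ H₂]
  exact not_exists_onLine_iff hα₁

end
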